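/- Let 0 < α < ω₁ and let X be a topological space. Then every α-embedded subset E of X which belongs to the α'th functionally multiplicative class in X is ambiguously α-embedded in X. -/

import Mathlib

open Set

universe u v

/-- `A` is functionally open in `X`: `A = f⁻¹((0,1])` for some continuous `f : X → [0,1]`. -/
def FunctionallyOpen (X : Type u) [TopologicalSpace X] (A : Set X) : Prop :=
  ∃ f : X → ℝ, Continuous f ∧ (∀ x, f x ∈ Set.Icc (0:ℝ) 1) ∧ A = f ⁻¹' (Set.Ioc 0 1)

/-- `A` is functionally closed in `X`: `A = f⁻¹(0)` for some continuous `f : X → [0,1]`. -/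
def FunctionallyClosed (X : Type u) [TopologicalSpace X] (A : Set X) : Prop :=
  ∃ f : X → ℝ, Continuous f ∧ (∀ x, f x ∈ Set.Icc (0:ℝ) 1) ∧ A = f ⁻¹' {0}

mutual
/-- The `α`'th functionally additive class in `X`. -/
inductive FunAdd (X : Type u) [TopologicalSpace X] : Ordinal.{0} → Set X → Prop where
  | base (A : Set X) : FunctionallyOpen X A → FunAdd X 0 A
  | union (α : Ordinal.{0}) (hα : α ≠ 0) (β : ℕ → Ordinal.{0}) (hβ : ∀ n, β n < α)
      (s : ℕ → Set X) (hs : ∀ n, FunMul X (β n) (s n)) : FunAdd X α (⋃ n, s n)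

/-- The `α`'th functionally multiplicative class in `X`. -/
inductive FunMul (X : Type u) [TopologicalSpace X] : Ordinal.{0} → Set X → Prop where
  | base (A : Set X) : FunctionallyClosed X A → FunMul X 0 A
  | inter (α : Ordinal.{0}) (hα : α ≠ 0) (β : ℕ → Ordinal.{0}) (hβ : ∀ n, β n < α)
      (s : ℕ → Set X) (hs : ∀ n, FunAdd X (β n) (s n)) : FunMul X α (⋂ n, s n)
end

mutual
/-- The `α`'th (ordinary) additive Borel class in `X`. -/
inductive BorelAdd (X : Type u) [TopologicalSpace X] : Ordinal.{0} → Set X → Prop where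
  | base (A : Set X) : IsOpen A → BorelAdd X 0 A
  | union (α : Ordinal.{0}) (hα : α ≠ 0) (β : ℕ → Ordinal.{0}) (hβ : ∀ n, β n < α)
      (s : ℕ → Set X) (hs : ∀ n, BorelMul X (β n) (s n)) : BorelAdd X α (⋃ n, s n)

/-- The `α`'th (ordinary) multiplicative Borel class in `X`. -/
inductive BorelMul (X : Type u) [TopologicalSpace X] : Ordinal.{0} → Set X → Prop where
  | base (A : Set X) : IsClosed A → BorelMul X 0 A
  | inter (α : Ordinal.{0}) (hα : α ≠ 0) (β : ℕ → Ordinal.{0}) (hβ : ∀ n, β n < α)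
      (s : ℕ → Set X) (hs : ∀ n, BorelAdd X (β n) (s n)) : BorelMul X α (⋂ n, s n)
end

/-- A set is functionally ambiguous of class `α` if it belongs to both the `α`'th functionally
additive and the `α`'th functionally multiplicative class. -/
def FunAmbiguous (X : Type u) [TopologicalSpace X] (α : Ordinal.{0}) (A : Set X) : Prop :=
  FunAdd X α A ∧ FunMul X α A

/-- `f ∈ K_α(X,Y)`: for `α = 0` continuity, for `α > 0` preimages of open sets belong to
the `α`'th functionally additive class. -/
def KClass {X : Type u} {Y : Type v} [TopologicalSpace X] [TopologicalSpace Y]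
    (α : Ordinal.{0}) (f : X → Y) : Prop :=
  (α = 0 → Continuous f) ∧ (α ≠ 0 → ∀ V : Set Y, IsOpen V → FunAdd X α (f ⁻¹' V))

/-- `A` and `B` are `α`-separated in `X`. -/
def AlphaSeparated {X : Type u} [TopologicalSpace X] (α : Ordinal.{0}) (A B : Set X) : Prop :=
  ∃ f : X → ℝ, KClass α f ∧ A ⊆ f ⁻¹' {0} ∧ B ⊆ f ⁻¹' {1}

/-- `X` is an `α`-separated space: any two disjoint sets of the `α`'th (ordinary)
multiplicative class are `α`-separated. -/
def AlphaSeparatedSpace (X : Type u) [TopologicalSpace X] (α : Ordinal.{0}) : Prop :=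
  ∀ A B : Set X, BorelMul X α A → BorelMul X α B → Disjoint A B → AlphaSeparated α A B

/-- `E` is `α`-embedded in `X`. -/
def AlphaEmbedded {X : Type u} [TopologicalSpace X] (α : Ordinal.{0}) (E : Set X) : Prop :=
  (∀ A : Set ↥E, FunAdd ↥E α A → ∃ B : Set X, FunAdd X α B ∧ Subtype.val '' A = B ∩ E) ∧
  (∀ A : Set ↥E, FunMul ↥E α A → ∃ B : Set X, FunMul X α B ∧ Subtype.val '' A = B ∩ E)

/-- `E` is ambiguously `α`-embedded in `X`. -/
def AmbiguouslyEmbedded {X : Type u} [TopologicalSpace X] (α : Ordinal.{0}) (E : Set X) : Prop :=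
  ∀ A : Set ↥E, FunAmbiguous ↥E α A →
    ∃ B : Set X, FunAmbiguous X α B ∧ Subtype.val '' A = B ∩ E

/-- The first uncountable ordinal. -/
noncomputable def omega1 : Ordinal.{0} := (Cardinal.aleph 1).ord

/-- `A` is an `F_σ`-set: a countable union of closed sets. -/
def IsFSigma {X : Type u} [TopologicalSpace X] (A : Set X) : Prop :=
  ∃ F : ℕ → Set X, (∀ n, IsClosed (F n)) ∧ A = ⋃ n, F n

/-- A space has a countable π-base. -/
def CountablePiBase (Z : Type v) [TopologicalSpace Z] : Prop :=
  ∃ 𝒰 : Set (Set Z), 𝒰.Countable ∧ (∀ U ∈ 𝒰, IsOpen U ∧ U.Nonempty) ∧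
    ∀ V : Set Z, IsOpen V → V.Nonempty → ∃ U ∈ 𝒰, U ⊆ V

theorem aux_compl {X : Type u} [TopologicalSpace X] (α : Ordinal.{0}) :
    (∀ A : Set X, FunAdd X α A → FunMul X α Aᶜ) ∧ (∀ A : Set X, FunMul X α A → FunAdd X α Aᶜ) := by
  induction α using WellFoundedLT.induction with
  | ind α ih =>
  constructor
  · intro A hA
    cases hA with
    | base _ h =>
      obtain ⟨f, hf, hf1, rfl⟩ := h
      refine FunMul.base _ ⟨f, hf, hf1, ?_⟩
      ext x
      have := hf1 x
      simp only [mem_compl_iff, mem_preimage, mem_Ioc, mem_singleton_iff, mem_Icc] at *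
      constructor
      · intro h; by_contra h'; exact h ⟨lt_of_le_of_ne this.1 (Ne.symm h'), this.2⟩
      · intro h h'; linarith [h'.1]
    | union _ h0 β hβ s hs =>
      rw [compl_iUnion]
      exact FunMul.inter _ h0 β hβ _ (fun n => (ih _ (hβ n)).2 _ (hs n))
  · intro A hA
    cases hA with
    | base _ h =>
      obtain ⟨f, hf, hf1, rfl⟩ := h
      refine FunAdd.base _ ⟨f, hf, hf1, ?_⟩
      ext x
      have := hf1 x
      simp only [mem_compl_iff, mem_preimage, mem_Ioc, mem_singleton_iff, mem_Icc] at *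
      constructor
      · intro h; exact ⟨lt_of_le_of_ne this.1 (Ne.symm h), this.2⟩
      · intro h h'; linarith [h.1]
    | inter _ h0 β hβ s hs =>
      rw [compl_iInter]
      exact FunAdd.union _ h0 β hβ _ (fun n => (ih _ (hβ n)).1 _ (hs n))

theorem aux_mono {X : Type u} [TopologicalSpace X] {β α : Ordinal.{0}} (h : β ≤ α) {A : Set X}
    (hA : FunMul X β A) : FunMul X α A := by
  cases hA with
  | base _ hc =>
    rcases eq_or_ne α 0 with rfl | h0
    · exact FunMul.base _ hc
    obtain ⟨f, hf, hf1, rfl⟩ := hc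
    have : f ⁻¹' {0} = ⋂ n : ℕ, {x | f x < 1 / ((n : ℝ) + 1)} := by
      ext x
      have hx := hf1 x
      simp only [mem_preimage, mem_singleton_iff, mem_iInter, mem_ofPred_eq, mem_Icc] at *
      constructor
      · intro h n; rw [h]; positivity
      · intro h
        by_contra h'
        obtain ⟨n, hn⟩ := exists_nat_one_div_lt (lt_of_le_of_ne hx.1 (Ne.symm h'))
        exact absurd (h n) (not_lt.2 hn.le)
    rw [this]
    refine FunMul.inter _ h0 (fun _ => 0) (fun _ => pos_iff_ne_zero.2 h0) _ (fun n => ?_)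
    refine FunAdd.base _ ⟨fun x => max 0 (1 / ((n : ℝ) + 1) - f x), by fun_prop, ?_, ?_⟩
    · intro x
      have hx := (hf1 x).1
      have : 1 / ((n : ℝ) + 1) ≤ 1 := by
        rw [div_le_one (by positivity)]; linarith [n.cast_nonneg (α := ℝ)]
      exact ⟨le_max_left _ _, max_le zero_le_one (by linarith)⟩
    · ext x
      have hx := (hf1 x).1
      have : 1 / ((n : ℝ) + 1) ≤ 1 := by
        rw [div_le_one (by positivity)]; linarith [n.cast_nonneg (α := ℝ)]
      simp only [mem_ofPred_eq, mem_preimage, mem_Ioc, lt_max_iff, lt_irrefl, false_or, sub_pos]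
      exact ⟨fun h => ⟨h, max_le zero_le_one (by linarith)⟩, fun h => h.1⟩
  | inter _ h0 γ hγ s hs =>
    exact FunMul.inter _ (fun h' => h0 (by rw [h'] at h; exact le_antisymm h (zero_le))) γ
      (fun n => (hγ n).trans_le h) s hs

theorem aux_iUnion {X : Type u} [TopologicalSpace X] {α : Ordinal.{0}} (h0 : α ≠ 0)
    (s : ℕ → Set X) (hs : ∀ n, FunAdd X α (s n)) : FunAdd X α (⋃ n, s n) := by
  have key : ∀ n, ∃ (β : ℕ → Ordinal.{0}) (t : ℕ → Set X), (∀ k, β k < α) ∧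
      (∀ k, FunMul X (β k) (t k)) ∧ s n = ⋃ k, t k := by
    intro n
    generalize hA : s n = A
    have h := hs n
    rw [hA] at h
    cases h with
    | base _ _ => exact absurd rfl h0
    | union _ _ β hβ t ht => exact ⟨β, t, hβ, ht, rfl⟩
  choose β t hβ ht he using key
  have : (⋃ n, s n) = ⋃ m : ℕ, t m.unpair.1 m.unpair.2 := by
    rw [Set.iUnion_unpair (fun i j => t i j)]
    exact iUnion_congr he
  rw [this]
  exact FunAdd.union _ h0 (fun m => β m.unpair.1 m.unpair.2) (fun m => hβ _ _) _ (fun m => ht _ _)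

theorem aux_mul_inter {X : Type u} [TopologicalSpace X] {α : Ordinal.{0}} {A B : Set X}
    (hA : FunMul X α A) (hB : FunMul X α B) : FunMul X α (A ∩ B) := by
  rcases eq_or_ne α 0 with rfl | h0
  · cases hA with
    | inter _ h _ _ _ _ => exact absurd rfl h
    | base _ ha =>
    cases hB with
    | inter _ h _ _ _ _ => exact absurd rfl h
    | base _ hb =>
    obtain ⟨f, hf, hf1, rfl⟩ := ha
    obtain ⟨g, hg, hg1, rfl⟩ := hb
    refine FunMul.base _ ⟨fun x => max (f x) (g x), by fun_prop, fun x =>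
      ⟨le_max_of_le_left (hf1 x).1, max_le (hf1 x).2 (hg1 x).2⟩, ?_⟩
    ext x
    have h1 := (hf1 x).1
    have h2 := (hg1 x).1
    simp only [mem_inter_iff, mem_preimage, mem_singleton_iff]
    constructor
    · rintro ⟨h, h'⟩; simp [h, h']
    · intro h
      have h3 := le_max_left (f x) (g x)
      have h4 := le_max_right (f x) (g x)
      constructor <;> linarith
  · have h1 := (aux_compl α).2 _ hA
    have h2 := (aux_compl α).2 _ hB
    have h3 : FunAdd X α (⋃ n : ℕ, if n = 0 then Aᶜ else Bᶜ) :=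
      aux_iUnion h0 _ (fun n => by split_ifs <;> assumption)
    have h4 := (aux_compl α).1 _ h3
    convert h4 using 1
    ext x
    simp only [mem_inter_iff, mem_compl_iff, mem_iUnion, not_exists]
    constructor
    · rintro ⟨h, h'⟩ n
      split_ifs <;> simpa
    · intro h
      have h5 := h 0
      have h6 := h 1
      simp at h5 h6
      exact ⟨h5, h6⟩

theorem aux_add_inter {X : Type u} [TopologicalSpace X] {α : Ordinal.{0}} (h0 : α ≠ 0) {A B : Set X}
    (hA : FunAdd X α A) (hB : FunAdd X α B) : FunAdd X α (A ∩ B) := by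
  cases hA with
  | base _ _ => exact absurd rfl h0
  | union _ _ β hβ s hs =>
  cases hB with
  | base _ _ => exact absurd rfl h0
  | union _ _ γ hγ t ht =>
  rw [iUnion_inter]
  refine aux_iUnion h0 _ (fun n => ?_)
  rw [inter_iUnion]
  exact FunAdd.union _ h0 (fun m => max (β n) (γ m)) (fun m => max_lt (hβ n) (hγ m)) _
    (fun m => aux_mul_inter (aux_mono (le_max_left _ _) (hs n)) (aux_mono (le_max_right _ _) (ht m)))

theorem aux_lower {X : Type u} [TopologicalSpace X] {β α : Ordinal.{0}} (h : β < α) {A : Set X}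
    (hA : FunMul X β A) : FunAdd X α A := by
  have := FunAdd.union α (pos_iff_ne_zero.1 ((zero_le).trans_lt h)) (fun _ => β) (fun _ => h)
    (fun _ => A) (fun _ => hA)
  rwa [iUnion_const] at this

theorem aux_fin {X : Type u} [TopologicalSpace X] {α : Ordinal.{0}} (h0 : α ≠ 0) {A : Set X}
    (hA : FunAdd X α A) (s : ℕ → Set X) (hs : ∀ n, FunAdd X α (s n)) (n : ℕ) :
    FunAdd X α (A ∩ {x | ∀ k < n, x ∈ s k}) := by
  induction n with
  | zero => simpa using hA
  | succ n ih =>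
    convert aux_add_inter h0 ih (hs n) using 1
    ext x
    simp only [mem_inter_iff, mem_ofPred_eq, Nat.lt_succ_iff_lt_or_eq]
    grind

theorem aux_sep {X : Type u} [TopologicalSpace X] {α : Ordinal.{0}} (h0 : α ≠ 0) {P Q : Set X}
    (hP : FunMul X α P) (hQ : FunMul X α Q) (hd : Disjoint P Q) :
    ∃ B, FunAmbiguous X α B ∧ P ⊆ B ∧ Disjoint B Q := by
  have h1 := (aux_compl α).2 _ hP
  have h2 := (aux_compl α).2 _ hQ
  generalize hU : Pᶜ = U at h1
  generalize hV : Qᶜ = V at h2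
  cases h1 with
  | base _ _ => exact absurd rfl h0
  | union _ _ β hβ u hu =>
  cases h2 with
  | base _ _ => exact absurd rfl h0
  | union _ _ γ hγ v hv =>
  have hu' : ∀ x, x ∉ P ↔ ∃ n, x ∈ u n := fun x => by
    have := congrArg (x ∈ ·) hU; simpa using this
  have hv' : ∀ x, x ∉ Q ↔ ∃ n, x ∈ v n := fun x => by
    have := congrArg (x ∈ ·) hV; simpa using this
  have huc : ∀ n, FunAdd X α (u n)ᶜ := fun n => (aux_compl α).2 _ (aux_mono (hβ n).le (hu n))
  have hvc : ∀ n, FunAdd X α (v n)ᶜ := fun n => (aux_compl α).2 _ (aux_mono (hγ n).le (hv n))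
  have hB : FunAdd X α (⋃ n, v n ∩ {x | ∀ k < n, x ∈ (u k)ᶜ}) :=
    aux_iUnion h0 _ (fun n => aux_fin h0 (aux_lower (hγ n) (hv n)) _ huc n)
  have hC : FunAdd X α (⋃ n, u n ∩ {x | ∀ k < n + 1, x ∈ (v k)ᶜ}) :=
    aux_iUnion h0 _ (fun n => aux_fin h0 (aux_lower (hβ n) (hu n)) _ hvc (n + 1))
  have hBC : (⋃ n, u n ∩ {x | ∀ k < n + 1, x ∈ (v k)ᶜ})ᶜ =
      ⋃ n, v n ∩ {x | ∀ k < n, x ∈ (u k)ᶜ} := by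
    ext x
    simp only [mem_compl_iff, mem_iUnion, mem_inter_iff, mem_ofPred_eq]
    constructor
    · intro h
      have hex : ∃ n, x ∈ u n ∨ x ∈ v n := by
        by_cases hx : x ∈ P
        · obtain ⟨n, hn⟩ := (hv' x).1 (fun hq => Set.disjoint_left.1 hd hx hq)
          exact ⟨n, Or.inr hn⟩
        · obtain ⟨n, hn⟩ := (hu' x).1 hx
          exact ⟨n, Or.inl hn⟩
      classical
      have hmin : ∀ k < Nat.find hex, ¬ (x ∈ u k ∨ x ∈ v k) := fun k hk => Nat.find_min hex hk
      have hsp := Nat.find_spec hex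
      generalize Nat.find hex = n at hmin hsp
      by_cases hvn : x ∈ v n
      · exact ⟨n, hvn, fun k hk h' => hmin k hk (Or.inl h')⟩
      · refine absurd ⟨n, hsp.resolve_right hvn, fun k hk h' => ?_⟩ h
        rcases Nat.lt_succ_iff_lt_or_eq.1 hk with hk | rfl
        · exact hmin k hk (Or.inr h')
        · exact hvn h'
    · rintro ⟨n, hn, hn'⟩ ⟨m, hm, hm'⟩
      rcases lt_or_ge m n with h | h
      · exact hn' m h hm
      · exact hm' n (Nat.lt_succ_of_le h) hn
  refine ⟨_, ⟨hB, hBC ▸ (aux_compl α).1 _ hC⟩, ?_, ?_⟩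
  · intro x hx
    obtain ⟨n, hn⟩ := (hv' x).1 (fun hq => Set.disjoint_left.1 hd hx hq)
    simp only [mem_iUnion]
    exact ⟨n, hn, fun k _ hk => (hu' x).2 ⟨k, hk⟩ hx⟩
  · rw [Set.disjoint_left]
    intro x hx
    simp only [mem_iUnion] at hx
    obtain ⟨n, hn, _⟩ := hx
    exact (hv' x).2 ⟨n, hn⟩

/-- every `α`-embedded set of the `α`'th functionally multiplicative class
is ambiguously `α`-embedded (`0 < α < ω₁`). -/
theorem stmt10 {X : Type u} [TopologicalSpace X] (α : Ordinal.{0}) (hα0 : 0 < α)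
    (hα : α < omega1) (E : Set X) (hE : AlphaEmbedded α E) (hEm : FunMul X α E) :
    AmbiguouslyEmbedded α E := by
  have h0 : α ≠ 0 := hα0.ne'
  intro A hA
  obtain ⟨B1, hB1, e1⟩ := hE.2 A hA.2
  obtain ⟨B2, hB2, e2⟩ := hE.2 Aᶜ ((aux_compl α).1 _ hA.1)
  have hd : Disjoint (B1 ∩ E) (B2 ∩ E) := by
    rw [← e1, ← e2, Set.disjoint_image_iff Subtype.val_injective]
    exact disjoint_compl_right
  obtain ⟨B, hB, hs, hdis⟩ := aux_sep h0 (aux_mul_inter hB1 hEm) (aux_mul_inter hB2 hEm) hd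
  refine ⟨B, hB, ?_⟩
  rw [← e1] at hs
  rw [← e2] at hdis
  ext x
  constructor
  · intro hx
    exact ⟨hs hx, by obtain ⟨y, _, rfl⟩ := hx; exact y.2⟩
  · rintro ⟨hx, hxE⟩
    by_contra hn
    exact Set.disjoint_left.1 hdis hx ⟨⟨x, hxE⟩, fun h => hn ⟨_, h, rfl⟩, rfl⟩
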